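/- For any m + n ≥ 1 and any r + s ≥ 1, the nilpotent Lie superalgebra H(m,n) ⊕ A(r | s) over a field F (char F ≠ 2,3) is capable if and only if m = 1 and n = 0. -/

import Mathlib

/-!
Common definitions: Lie superalgebras over a field `F` (char ≠ 2,3 where needed),
graded ideals, centers, capability, epicenter, non-abelian tensor and exterior
products (characterized by generators-and-relations universal properties),
free Lie superalgebras, Schur multipliers, Heisenberg Lie superalgebras, etc.
-/

namespace SuperLie

open Submodule Function Module

universe u v w

/-- The sign `(-1)^{|a||b|}` attached to a pair of `ℤ₂`-degrees. -/
def sg (F : Type u) [Field F] (a b : ZMod 2) : F := (-1 : F) ^ (a.val * b.val)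

/-- A Lie superalgebra over `F`: a `ℤ₂`-graded vector space `L = L₀ ⊕ L₁`
together with an even bilinear bracket satisfying graded skew-symmetry and the
graded Jacobi identity (on homogeneous elements). -/
class LieSuper (F : Type u) [Field F] (L : Type v) [AddCommGroup L] [Module F L] where
  gr : ZMod 2 → Submodule F L
  isCompl_gr : IsCompl (gr 0) (gr 1)
  br : L → L → L
  br_add_left : ∀ x y z : L, br (x + y) z = br x z + br y z
  br_add_right : ∀ x y z : L, br x (y + z) = br x y + br x z
  br_smul_left : ∀ (c : F) (x y : L), br (c • x) y = c • br x y
  br_smul_right : ∀ (c : F) (x y : L), br x (c • y) = c • br x y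
  br_gr : ∀ a b : ZMod 2, ∀ x ∈ gr a, ∀ y ∈ gr b, br x y ∈ gr (a + b)
  br_skew : ∀ a b : ZMod 2, ∀ x ∈ gr a, ∀ y ∈ gr b, br x y = -(sg F a b) • br y x
  br_jacobi : ∀ a b c : ZMod 2, ∀ x ∈ gr a, ∀ y ∈ gr b, ∀ z ∈ gr c,
    sg F a c • br x (br y z) + sg F b a • br y (br z x) + sg F c b • br z (br x y) = 0

/-- The `a`-graded piece of a Lie superalgebra. -/
def grd (F : Type u) [Field F] (L : Type v) [AddCommGroup L] [Module F L] [LieSuper F L]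
    (a : ZMod 2) : Submodule F L :=
  LieSuper.gr a

/-- The bracket of a Lie superalgebra. -/
def sbr (F : Type u) [Field F] {L : Type v} [AddCommGroup L] [Module F L] [LieSuper F L]
    (x y : L) : L :=
  LieSuper.br (F := F) x y

/-- The center `Z(L) = {z ∈ L : [z,x] = 0 for all x ∈ L}`. -/
def centerS (F : Type u) [Field F] (L : Type v) [AddCommGroup L] [Module F L] [LieSuper F L] :
    Submodule F L where
  carrier := {z : L | ∀ x : L, sbr F z x = 0}
  add_mem' := by
    intro a b ha hb x
    simp only [Set.mem_setOf_eq, sbr] at ha hb ⊢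
    rw [LieSuper.br_add_left, ha x, hb x, add_zero]
  zero_mem' := by
    intro x
    have h := LieSuper.br_smul_left (F := F) (0 : F) (0 : L) x
    simp only [Set.mem_setOf_eq, sbr, zero_smul] at h ⊢
    simpa using h
  smul_mem' := by
    intro c a ha x
    simp only [Set.mem_setOf_eq, sbr] at ha ⊢
    rw [LieSuper.br_smul_left, ha x, smul_zero]

/-- Homomorphisms of Lie superalgebras: even (grading preserving) linear maps
which preserve the bracket. -/
def IsHom (F : Type u) [Field F] {L : Type v} {M : Type w}
    [AddCommGroup L] [Module F L] [LieSuper F L]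
    [AddCommGroup M] [Module F M] [LieSuper F M] (f : L →ₗ[F] M) : Prop :=
  (∀ a : ZMod 2, ∀ x ∈ grd F L a, f x ∈ grd F M a) ∧
  (∀ x y : L, f (sbr F x y) = sbr F (f x) (f y))

/-- A bundled Lie superalgebra over `F`. -/
structure LieSupAlg (F : Type u) [Field F] : Type (max u (v + 1)) where
  carrier : Type v
  [iag : AddCommGroup carrier]
  [imo : Module F carrier]
  [ils : LieSuper F carrier]

attribute [instance] LieSupAlg.iag LieSupAlg.imo LieSupAlg.ils

instance (F : Type u) [Field F] : CoeSort (LieSupAlg.{u, v} F) (Type v) :=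
  ⟨LieSupAlg.carrier⟩

/-- A Lie superalgebra `L` is capable if `L ≅ H/Z(H)` for some Lie superalgebra `H`,
i.e. there is a surjective homomorphism onto `L` whose kernel is exactly the center. -/
def Capable (F : Type u) [Field F] (L : Type v) [AddCommGroup L] [Module F L]
    [LieSuper F L] : Prop :=
  ∃ (H : LieSupAlg.{u, max u v} F) (φ : H.carrier →ₗ[F] L),
    IsHom F φ ∧ Surjective φ ∧ LinearMap.ker φ = centerS F H.carrier

/-- Graded ideals of a Lie superalgebra. -/
def IsGIdeal (F : Type u) [Field F] {L : Type v} [AddCommGroup L] [Module F L]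
    [LieSuper F L] (I : Submodule F L) : Prop :=
  (∀ x ∈ I, ∀ y : L, sbr F x y ∈ I) ∧ (∀ y : L, ∀ x ∈ I, sbr F y x ∈ I) ∧
  (∀ x ∈ I, ∃ x0 ∈ I ⊓ grd F L 0, ∃ x1 ∈ I ⊓ grd F L 1, x = x0 + x1)

/-- The graded ideal generated by a subset. -/
def idealClosure (F : Type u) [Field F] {L : Type v} [AddCommGroup L] [Module F L]
    [LieSuper F L] (S : Set L) : Submodule F L :=
  sInf {I : Submodule F L | IsGIdeal F I ∧ S ⊆ ↑I}

/-- `QuotCapable F L N` expresses that the quotient Lie superalgebra `L/N` is capable. -/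
def QuotCapable (F : Type u) [Field F] (L : Type v) [AddCommGroup L] [Module F L]
    [LieSuper F L] (N : Submodule F L) : Prop :=
  ∃ (Q : LieSupAlg.{u, max u v} F) (π : L →ₗ[F] Q.carrier),
    IsHom F π ∧ Surjective π ∧ LinearMap.ker π = N ∧ Capable F Q.carrier

/-- The epicenter `Z^*(L)`: the smallest graded ideal of `L` such that the
corresponding quotient is capable. -/
def IsEpicenter (F : Type u) [Field F] (L : Type v) [AddCommGroup L] [Module F L]
    [LieSuper F L] (Z : Submodule F L) : Prop :=
  IsGIdeal F Z ∧ QuotCapable F L Z ∧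
  ∀ N : Submodule F L, IsGIdeal F N → QuotCapable F L N → Z ≤ N

/-- The submodule `[I,J]` spanned by brackets. -/
def bracketSpan (F : Type u) [Field F] {L : Type v} [AddCommGroup L] [Module F L]
    [LieSuper F L] (I J : Submodule F L) : Submodule F L :=
  Submodule.span F {z : L | ∃ x ∈ I, ∃ y ∈ J, z = sbr F x y}

/-- The derived subalgebra `L' = [L,L]`. -/
def derived (F : Type u) [Field F] (L : Type v) [AddCommGroup L] [Module F L]
    [LieSuper F L] : Submodule F L :=
  bracketSpan F (⊤ : Submodule F L) ⊤

/-- The lower central series of a Lie superalgebra. -/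
def lowerCentral (F : Type u) [Field F] (L : Type v) [AddCommGroup L] [Module F L]
    [LieSuper F L] : ℕ → Submodule F L
  | 0 => ⊤
  | n + 1 => bracketSpan F (lowerCentral F L n) ⊤

/-- A Lie superalgebra is nilpotent if its lower central series terminates at zero. -/
def IsNilp (F : Type u) [Field F] (L : Type v) [AddCommGroup L] [Module F L]
    [LieSuper F L] : Prop :=
  ∃ n : ℕ, lowerCentral F L n = ⊥

/-- An action of a Lie superalgebra `P` on a Lie superalgebra `M`:
an even bilinear map satisfying the two action axioms. -/
structure IsAction (F : Type u) [Field F] {P : Type v} {M : Type v}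
    [AddCommGroup P] [Module F P] [LieSuper F P]
    [AddCommGroup M] [Module F M] [LieSuper F M] (act : P → M → M) : Prop where
  add_left : ∀ (p q : P) (m : M), act (p + q) m = act p m + act q m
  add_right : ∀ (p : P) (m m' : M), act p (m + m') = act p m + act p m'
  smul_left : ∀ (c : F) (p : P) (m : M), act (c • p) m = c • act p m
  smul_right : ∀ (c : F) (p : P) (m : M), act p (c • m) = c • act p m
  grade : ∀ a b : ZMod 2, ∀ p ∈ grd F P a, ∀ m ∈ grd F M b, act p m ∈ grd F M (a + b)
  br_act : ∀ a b : ZMod 2, ∀ p ∈ grd F P a, ∀ p' ∈ grd F P b, ∀ m : M,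
    act (sbr F p p') m = act p (act p' m) - sg F a b • act p' (act p m)
  act_br : ∀ a b : ZMod 2, ∀ p ∈ grd F P a, ∀ m ∈ grd F M b, ∀ m' : M,
    act p (sbr F m m') = sbr F (act p m) m' + sg F a b • sbr F m (act p m')

/-- Compatibility of mutual actions of two Lie superalgebras on each other. -/
def Compatible (F : Type u) [Field F] {M : Type v} {N : Type v}
    [AddCommGroup M] [Module F M] [LieSuper F M]
    [AddCommGroup N] [Module F N] [LieSuper F N]
    (actMN : M → N → N) (actNM : N → M → M) : Prop :=
  (∀ a b : ZMod 2, ∀ m ∈ grd F M a, ∀ n ∈ grd F N b, ∀ n' : N,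
      actMN (actNM n m) n' = -(sg F a b) • sbr F (actMN m n) n') ∧
  (∀ a b : ZMod 2, ∀ m ∈ grd F M a, ∀ n ∈ grd F N b, ∀ m' : M,
      actNM (actMN m n) m' = -(sg F a b) • sbr F (actNM n m) m')

/-- The defining relations of the non-abelian tensor product `M ⊗ N` of Lie
superalgebras (with given mutual actions), satisfied by a pairing `q` into `T`. -/
structure TensorRel (F : Type u) [Field F] {M : Type v} {N : Type v} {T : Type w}
    [AddCommGroup M] [Module F M] [LieSuper F M]
    [AddCommGroup N] [Module F N] [LieSuper F N]
    [AddCommGroup T] [Module F T] [LieSuper F T]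
    (actMN : M → N → N) (actNM : N → M → M) (q : M → N → T) : Prop where
  add_left : ∀ (m m' : M) (n : N), q (m + m') n = q m n + q m' n
  add_right : ∀ (m : M) (n n' : N), q m (n + n') = q m n + q m n'
  smul_left : ∀ (c : F) (m : M) (n : N), q (c • m) n = c • q m n
  smul_right : ∀ (c : F) (m : M) (n : N), q m (c • n) = c • q m n
  grade : ∀ a b : ZMod 2, ∀ m ∈ grd F M a, ∀ n ∈ grd F N b, q m n ∈ grd F T (a + b)
  brk_left : ∀ a b : ZMod 2, ∀ m ∈ grd F M a, ∀ m' ∈ grd F M b, ∀ n : N,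
    q (sbr F m m') n = q m (actMN m' n) - sg F a b • q m' (actMN m n)
  brk_right : ∀ a b c : ZMod 2, ∀ m ∈ grd F M a, ∀ n ∈ grd F N b, ∀ n' ∈ grd F N c,
    q m (sbr F n n') = sg F c (a + b) • q (actNM n' m) n - sg F a b • q (actNM n m) n'
  brk_brk : ∀ a b : ZMod 2, ∀ m ∈ grd F M a, ∀ n ∈ grd F N b, ∀ (m' : M) (n' : N),
    sbr F (q m n) (q m' n') = -(sg F a b) • q (actNM n m) (actMN m' n')

/-- `IsTensorObj F actMN actNM t` says that `(T, t)` is the non-abelian tensor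
product `M ⊗ N`: the pairing `t` satisfies the defining relations and is
universal among all pairings satisfying them. -/
structure IsTensorObj (F : Type u) [Field F] {M : Type v} {N : Type v} {T : Type v}
    [AddCommGroup M] [Module F M] [LieSuper F M]
    [AddCommGroup N] [Module F N] [LieSuper F N]
    [AddCommGroup T] [Module F T] [LieSuper F T]
    (actMN : M → N → N) (actNM : N → M → M) (t : M → N → T) : Prop where
  rel : TensorRel F actMN actNM t
  lift : ∀ (Q : LieSupAlg.{u, max u v} F) (q : M → N → Q.carrier),
    TensorRel F actMN actNM q →
    ∃! h : T →ₗ[F] Q.carrier, IsHom F h ∧ ∀ (m : M) (n : N), h (t m n) = q m n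

/-- The defining relations of the non-abelian exterior square `L ∧ L` of a Lie
superalgebra (the tensor relations for the bracket actions, together with the
graded alternating relations coming from `L □ L`). -/
structure ExtRel (F : Type u) [Field F] {L : Type v} {T : Type w}
    [AddCommGroup L] [Module F L] [LieSuper F L]
    [AddCommGroup T] [Module F T] [LieSuper F T] (q : L → L → T) : Prop where
  toTensor : TensorRel F (fun x y : L => sbr F x y) (fun x y : L => sbr F x y) q
  alt : ∀ a b : ZMod 2, ∀ x ∈ grd F L a, ∀ y ∈ grd F L b, q x y = -(sg F a b) • q y x
  alt_even : ∀ x ∈ grd F L 0, q x x = 0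

/-- `IsExtObj F t` says that `(E, t)` is the non-abelian exterior square `L ∧ L`. -/
structure IsExtObj (F : Type u) [Field F] {L : Type v} {E : Type v}
    [AddCommGroup L] [Module F L] [LieSuper F L]
    [AddCommGroup E] [Module F E] [LieSuper F E] (t : L → L → E) : Prop where
  rel : ExtRel F t
  lift : ∀ (Q : LieSupAlg.{u, max u v} F) (q : L → L → Q.carrier),
    ExtRel F q →
    ∃! h : E →ₗ[F] Q.carrier, IsHom F h ∧ ∀ x y : L, h (t x y) = q x y

/-- A free Lie superalgebra: free on some `ℤ₂`-graded subset `X`. -/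
def IsFreeLieSuper (F : Type u) [Field F] (Fr : Type v) [AddCommGroup Fr] [Module F Fr]
    [LieSuper F Fr] : Prop :=
  ∃ X : ZMod 2 → Set Fr,
    (∀ a : ZMod 2, X a ⊆ (grd F Fr a : Set Fr)) ∧
    ∀ (Q : LieSupAlg.{u, max u v} F) (f : ∀ a : ZMod 2, X a → Q.carrier),
      (∀ (a : ZMod 2) (x : X a), f a x ∈ grd F Q.carrier a) →
      ∃! h : Fr →ₗ[F] Q.carrier,
        IsHom F h ∧ ∀ (a : ZMod 2) (x : X a), h (x : Fr) = f a x

/-- `F' ∩ R`, for a free presentation with kernel `R`. -/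
abbrev schurA (F : Type u) [Field F] (Fr : Type v) [AddCommGroup Fr] [Module F Fr]
    [LieSuper F Fr] (R : Submodule F Fr) : Submodule F Fr :=
  derived F Fr ⊓ R

/-- The Schur multiplier `M(L) = (F' ∩ R)/[R,F]` attached to a free presentation
`0 → R → F → L → 0`. -/
abbrev SchurMul (F : Type u) [Field F] (Fr : Type v) [AddCommGroup Fr] [Module F Fr]
    [LieSuper F Fr] (R : Submodule F Fr) :=
  ↥(schurA F Fr R) ⧸ (Submodule.comap (schurA F Fr R).subtype (bracketSpan F R ⊤))

/-- `L` is (isomorphic to) the special Heisenberg Lie superalgebra `H(m,n)` with even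
center: basis `x₁,…,x_{2m}, z` (even), `y₁,…,y_n` (odd), with `[xᵢ, x_{m+i}] = z`,
`[y_j, y_j] = z` and `z` central. -/
def IsHeisE (F : Type u) [Field F] (m n : ℕ) (L : Type v) [AddCommGroup L] [Module F L]
    [LieSuper F L] : Prop :=
  ∃ (x : Fin (2 * m) → L) (y : Fin n → L) (z : L),
    (∀ i, x i ∈ grd F L 0) ∧ z ∈ grd F L 0 ∧ (∀ j, y j ∈ grd F L 1) ∧
    LinearIndependent F (Sum.elim x (Sum.elim y (fun _ : Unit => z))) ∧
    Submodule.span F (Set.range (Sum.elim x (Sum.elim y (fun _ : Unit => z)))) = ⊤ ∧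
    (∀ i j : Fin (2 * m), sbr F (x i) (x j) =
      if (j : ℕ) = (i : ℕ) + m then z else if (i : ℕ) = (j : ℕ) + m then -z else 0) ∧
    (∀ (i : Fin (2 * m)) (j : Fin n), sbr F (x i) (y j) = 0) ∧
    (∀ (i : Fin (2 * m)) (j : Fin n), sbr F (y j) (x i) = 0) ∧
    (∀ i j : Fin n, sbr F (y i) (y j) = if i = j then z else 0) ∧
    (∀ w : L, sbr F z w = 0) ∧ (∀ w : L, sbr F w z = 0)

/-- `L` is (isomorphic to) the Heisenberg Lie superalgebra `H_m` with odd center: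
basis `x₁,…,x_m` (even), `y₁,…,y_m, z` (odd), with `[x_j, y_j] = z` and `z` central. -/
def IsHeisO (F : Type u) [Field F] (m : ℕ) (L : Type v) [AddCommGroup L] [Module F L]
    [LieSuper F L] : Prop :=
  ∃ (x : Fin m → L) (y : Fin m → L) (z : L),
    (∀ i, x i ∈ grd F L 0) ∧ (∀ j, y j ∈ grd F L 1) ∧ z ∈ grd F L 1 ∧
    LinearIndependent F (Sum.elim x (Sum.elim y (fun _ : Unit => z))) ∧
    Submodule.span F (Set.range (Sum.elim x (Sum.elim y (fun _ : Unit => z)))) = ⊤ ∧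
    (∀ i j : Fin m, sbr F (x i) (x j) = 0) ∧
    (∀ i j : Fin m, sbr F (x i) (y j) = if i = j then z else 0) ∧
    (∀ i j : Fin m, sbr F (y j) (x i) = if i = j then -z else 0) ∧
    (∀ i j : Fin m, sbr F (y i) (y j) = 0) ∧
    (∀ w : L, sbr F z w = 0) ∧ (∀ w : L, sbr F w z = 0)

/-- `A` is (isomorphic to) the abelian Lie superalgebra `A(r | s)` of
superdimension `(r | s)`. -/
def IsAbelSuper (F : Type u) [Field F] (r s : ℕ) (A : Type v) [AddCommGroup A]
    [Module F A] [LieSuper F A] : Prop :=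
  (∀ x y : A, sbr F x y = 0) ∧ Module.Finite F A ∧
  Module.finrank F ↥(grd F A 0) = r ∧ Module.finrank F ↥(grd F A 1) = s

/-- The direct sum (product) of two Lie superalgebras. -/
instance prodLieSuper (F : Type u) [Field F] (A : Type v) (B : Type w)
    [AddCommGroup A] [Module F A] [LieSuper F A]
    [AddCommGroup B] [Module F B] [LieSuper F B] : LieSuper F (A × B) where
  gr a := (grd F A a).prod (grd F B a)
  isCompl_gr := by
    have hA : IsCompl (grd F A 0) (grd F A 1) := LieSuper.isCompl_gr
    have hB : IsCompl (grd F B 0) (grd F B 1) := LieSuper.isCompl_gr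
    constructor
    · rw [disjoint_iff, eq_bot_iff]
      rintro ⟨a, b⟩ h
      rw [Submodule.mem_inf] at h
      obtain ⟨h0, h1⟩ := h
      rw [Submodule.mem_prod] at h0 h1
      have ha : a = 0 := by
        have := hA.disjoint.le_bot (Submodule.mem_inf.mpr ⟨h0.1, h1.1⟩)
        simpa using this
      have hb : b = 0 := by
        have := hB.disjoint.le_bot (Submodule.mem_inf.mpr ⟨h0.2, h1.2⟩)
        simpa using this
      simp [ha, hb, Prod.ext_iff]
    · rw [codisjoint_iff, eq_top_iff]
      rintro ⟨a, b⟩ -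
      have ha' : a ∈ grd F A 0 ⊔ grd F A 1 := by
        rw [hA.codisjoint.eq_top]; trivial
      have hb' : b ∈ grd F B 0 ⊔ grd F B 1 := by
        rw [hB.codisjoint.eq_top]; trivial
      obtain ⟨a0, ha0, a1, ha1, rfl⟩ := Submodule.mem_sup.mp ha'
      obtain ⟨b0, hb0, b1, hb1, rfl⟩ := Submodule.mem_sup.mp hb'
      refine Submodule.mem_sup.mpr ⟨(a0, b0), ?_, (a1, b1), ?_, ?_⟩
      · exact Submodule.mem_prod.mpr ⟨ha0, hb0⟩
      · exact Submodule.mem_prod.mpr ⟨ha1, hb1⟩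
      · rfl
  br x y := (sbr F x.1 y.1, sbr F x.2 y.2)
  br_add_left := by
    intro x y z
    simp only [Prod.fst_add, Prod.snd_add, sbr, LieSuper.br_add_left]
    rfl
  br_add_right := by
    intro x y z
    simp only [Prod.fst_add, Prod.snd_add, sbr, LieSuper.br_add_right]
    rfl
  br_smul_left := by
    intro c x y
    simp only [Prod.smul_fst, Prod.smul_snd, sbr, LieSuper.br_smul_left]
    rfl
  br_smul_right := by
    intro c x y
    simp only [Prod.smul_fst, Prod.smul_snd, sbr, LieSuper.br_smul_right]
    rfl
  br_gr := by
    intro a b x hx y hy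
    rw [Submodule.mem_prod] at hx hy ⊢
    exact ⟨LieSuper.br_gr a b x.1 hx.1 y.1 hy.1, LieSuper.br_gr a b x.2 hx.2 y.2 hy.2⟩
  br_skew := by
    intro a b x hx y hy
    rw [Submodule.mem_prod] at hx hy
    have h1 := LieSuper.br_skew (F := F) a b x.1 hx.1 y.1 hy.1
    have h2 := LieSuper.br_skew (F := F) a b x.2 hx.2 y.2 hy.2
    simp only [sbr]
    rw [Prod.ext_iff]
    exact ⟨h1, h2⟩
  br_jacobi := by
    intro a b c x hx y hy z hz
    rw [Submodule.mem_prod] at hx hy hz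
    have h1 := LieSuper.br_jacobi (F := F) a b c x.1 hx.1 y.1 hy.1 z.1 hz.1
    have h2 := LieSuper.br_jacobi (F := F) a b c x.2 hx.2 y.2 hy.2 z.2 hz.2
    simp only [sbr]
    rw [Prod.ext_iff]
    exact ⟨h1, h2⟩

section Aux

variable {F : Type u} [Field F]

theorem sg_ne_zero (a b : ZMod 2) : sg F a b ≠ 0 := by
  unfold sg
  exact pow_ne_zero _ (by simp)

theorem sg_zero_left (b : ZMod 2) : sg F 0 b = 1 := by simp [sg]

theorem sg_zero_right (b : ZMod 2) : sg F b 0 = 1 := by simp [sg]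

theorem sg_one_one : sg F 1 1 = -1 := by
  have : (1 : ZMod 2).val = 1 := rfl
  simp [sg, this]

theorem par (a : ZMod 2) : a = 0 ∨ a = 1 := by revert a; decide

section Basic

variable {L : Type v} [AddCommGroup L] [Module F L] [LieSuper F L]

theorem sbr_add_left (x y z : L) : sbr F (x + y) z = sbr F x z + sbr F y z :=
  LieSuper.br_add_left x y z

theorem sbr_add_right (x y z : L) : sbr F x (y + z) = sbr F x y + sbr F x z :=
  LieSuper.br_add_right x y z

theorem sbr_smul_left (c : F) (x y : L) : sbr F (c • x) y = c • sbr F x y :=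
  LieSuper.br_smul_left c x y

theorem sbr_smul_right (c : F) (x y : L) : sbr F x (c • y) = c • sbr F x y :=
  LieSuper.br_smul_right c x y

theorem sbr_zero_left (y : L) : sbr F (0 : L) y = 0 := by
  have := sbr_smul_left (0 : F) (0 : L) y
  simpa using this

theorem sbr_zero_right (y : L) : sbr F y (0 : L) = 0 := by
  have := sbr_smul_right (0 : F) y (0 : L)
  simpa using this

theorem grd_decomp (x : L) : ∃ x0 ∈ grd F L 0, ∃ x1 ∈ grd F L 1, x0 + x1 = x := by
  have h : IsCompl (grd F L 0) (grd F L 1) := LieSuper.isCompl_gr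
  have hx : x ∈ grd F L 0 ⊔ grd F L 1 := by rw [h.codisjoint.eq_top]; trivial
  exact Submodule.mem_sup.mp hx

theorem grd_disj (x : L) (h0 : x ∈ grd F L 0) (h1 : x ∈ grd F L 1) : x = 0 := by
  have h : IsCompl (grd F L 0) (grd F L 1) := LieSuper.isCompl_gr
  have := h.disjoint.le_bot (Submodule.mem_inf.mpr ⟨h0, h1⟩)
  simpa using this

theorem grd_br {a b : ZMod 2} {x y : L} (hx : x ∈ grd F L a) (hy : y ∈ grd F L b) :
    sbr F x y ∈ grd F L (a + b) := LieSuper.br_gr a b x hx y hy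

theorem sbr_skew {a b : ZMod 2} {x y : L} (hx : x ∈ grd F L a) (hy : y ∈ grd F L b) :
    sbr F x y = -(sg F a b) • sbr F y x := LieSuper.br_skew a b x hx y hy

theorem sbr_comm_zero {a b : ZMod 2} {x y : L} (hx : x ∈ grd F L a) (hy : y ∈ grd F L b)
    (h : sbr F x y = 0) : sbr F y x = 0 := by
  rw [sbr_skew hy hx, h, smul_zero]

theorem sbr_jacobi {a b c : ZMod 2} {x y z : L} (hx : x ∈ grd F L a) (hy : y ∈ grd F L b)
    (hz : z ∈ grd F L c) :
    sg F a c • sbr F x (sbr F y z) + sg F b a • sbr F y (sbr F z x)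
      + sg F c b • sbr F z (sbr F x y) = 0 := LieSuper.br_jacobi a b c x hx y hy z hz

end Basic

section Cap

variable {K : Type w} [AddCommGroup K] [Module F K] [LieSuper F K]
  {L : Type v} [AddCommGroup L] [Module F L] [LieSuper F L] {φ : K →ₗ[F] L}

theorem lift_hom (hφ : IsHom F φ) (hs : Surjective φ) (a : ZMod 2) (u : L)
    (hu : u ∈ grd F L a) : ∃ U ∈ grd F K a, φ U = u := by
  obtain ⟨U, rfl⟩ := hs u
  obtain ⟨U0, h0, U1, h1, rfl⟩ := grd_decomp (F := F) U
  have g0 := hφ.1 0 U0 h0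
  have g1 := hφ.1 1 U1 h1
  rw [map_add] at hu
  have ha : a = 0 ∨ a = 1 := par a
  rcases ha with rfl | rfl
  · refine ⟨U0, h0, ?_⟩
    have : φ U1 ∈ grd F L 0 := by
      have := Submodule.sub_mem _ hu g0
      simpa using this
    rw [map_add, grd_disj (F := F) _ this g1, add_zero]
  · refine ⟨U1, h1, ?_⟩
    have : φ U0 ∈ grd F L 1 := by
      have := Submodule.sub_mem _ hu g1
      simpa using this
    rw [map_add, grd_disj (F := F) _ g0 this, zero_add]

theorem cen_left (hk : LinearMap.ker φ = centerS F K) {c : K} (hc : φ c = 0) (x : K) :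
    sbr F c x = 0 := by
  have : c ∈ centerS F K := by rw [← hk]; exact hc
  exact this x

theorem cen_right (hφ : IsHom F φ) (hk : LinearMap.ker φ = centerS F K) {c : K}
    (hc : φ c = 0) (x : K) : sbr F x c = 0 := by
  obtain ⟨c0, h0, c1, h1, rfl⟩ := grd_decomp (F := F) c
  obtain ⟨x0, k0, x1, k1, rfl⟩ := grd_decomp (F := F) x
  have g0 := hφ.1 0 c0 h0
  have g1 := hφ.1 1 c1 h1
  rw [map_add] at hc
  have e0 : φ c0 = 0 := by
    refine grd_disj (F := F) _ g0 ?_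
    rw [eq_neg_of_add_eq_zero_left hc]
    exact Submodule.neg_mem _ g1
  have e1 : φ c1 = 0 := by rwa [e0, zero_add] at hc
  simp only [sbr_add_left, sbr_add_right]
  rw [sbr_comm_zero h0 k0 (cen_left hk e0 _), sbr_comm_zero h0 k1 (cen_left hk e0 _),
    sbr_comm_zero h1 k0 (cen_left hk e1 _), sbr_comm_zero h1 k1 (cen_left hk e1 _)]
  simp

/-- any lift of `z` commutes with any lift of `w` -/
def Ann (F : Type u) [Field F] {K : Type w} [AddCommGroup K] [Module F K] [LieSuper F K]
    {L : Type v} [AddCommGroup L] [Module F L] (φ : K →ₗ[F] L) (z w : L) : Prop :=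
  ∀ Z W : K, φ Z = z → φ W = w → sbr F Z W = 0

theorem ann_of (hφ : IsHom F φ) (hk : LinearMap.ker φ = centerS F K) {z w : L} (Z' W' : K)
    (hZ : φ Z' = z) (hW : φ W' = w) (h : sbr F Z' W' = 0) : Ann F φ z w := by
  intro Z W h1 h2
  have e1 : φ (Z - Z') = 0 := by rw [map_sub, h1, hZ, sub_self]
  have e2 : φ (W - W') = 0 := by rw [map_sub, h2, hW, sub_self]
  have : sbr F Z W = sbr F ((Z - Z') + Z') ((W - W') + W') := by simp
  rw [this, sbr_add_left, sbr_add_right, sbr_add_right, h, cen_left hk e1, cen_left hk e1,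
    cen_right hφ hk e2]
  simp

theorem ann_add (hφ : IsHom F φ) (hs : Surjective φ) (hk : LinearMap.ker φ = centerS F K)
    {z w w' : L} (h : Ann F φ z w) (h' : Ann F φ z w') : Ann F φ z (w + w') := by
  obtain ⟨Z, hZ⟩ := hs z
  obtain ⟨W, hW⟩ := hs w
  obtain ⟨W', hW'⟩ := hs w'
  refine ann_of hφ hk Z (W + W') hZ (by rw [map_add, hW, hW']) ?_
  rw [sbr_add_right, h Z W hZ hW, h' Z W' hZ hW', add_zero]

theorem ann_smul (hφ : IsHom F φ) (hs : Surjective φ) (hk : LinearMap.ker φ = centerS F K)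
    {z w : L} (c : F) (h : Ann F φ z w) : Ann F φ z (c • w) := by
  obtain ⟨Z, hZ⟩ := hs z
  obtain ⟨W, hW⟩ := hs w
  refine ann_of hφ hk Z (c • W) hZ (by rw [map_smul, hW]) ?_
  rw [sbr_smul_right, h Z W hZ hW, smul_zero]

theorem ann_zero (hφ : IsHom F φ) (hs : Surjective φ) (hk : LinearMap.ker φ = centerS F K)
    {z : L} : Ann F φ z 0 := by
  obtain ⟨Z, hZ⟩ := hs z
  exact ann_of hφ hk Z 0 hZ (map_zero _) (sbr_zero_right _)

theorem ann_pair (hφ : IsHom F φ) (hs : Surjective φ) (hk : LinearMap.ker φ = centerS F K)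
    {a b c : ZMod 2} {x y z w : L} (hx : x ∈ grd F L a) (hy : y ∈ grd F L b)
    (hw : w ∈ grd F L c) (hz : sbr F x y = z) (h1 : sbr F y w = 0) (h2 : sbr F w x = 0) :
    Ann F φ z w := by
  obtain ⟨X, gX, rfl⟩ := lift_hom hφ hs a x hx
  obtain ⟨Y, gY, rfl⟩ := lift_hom hφ hs b y hy
  obtain ⟨W, gW, rfl⟩ := lift_hom hφ hs c w hw
  refine ann_of hφ hk (sbr F X Y) W (by rw [hφ.2, hz]) rfl ?_
  have J := sbr_jacobi gX gY gW
  rw [cen_right hφ hk (c := sbr F Y W) (by rw [hφ.2, h1]),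
    cen_right hφ hk (c := sbr F W X) (by rw [hφ.2, h2])] at J
  simp only [smul_zero, zero_add] at J
  have J' := (smul_eq_zero.mp J).resolve_left (sg_ne_zero _ _)
  exact sbr_comm_zero gW (grd_br gX gY) J'

theorem ann_odd (hchar3 : (3 : F) ≠ 0) (hφ : IsHom F φ) (hs : Surjective φ)
    (hk : LinearMap.ker φ = centerS F K)
    {y z : L} (hy : y ∈ grd F L 1) (hz : sbr F y y = z) : Ann F φ z y := by
  obtain ⟨Y, gY, rfl⟩ := lift_hom hφ hs 1 y hy
  refine ann_of hφ hk (sbr F Y Y) Y (by rw [hφ.2, hz]) rfl ?_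
  have J := sbr_jacobi gY gY gY
  rw [sg_one_one, ← add_smul, ← add_smul] at J
  have J' := (smul_eq_zero.mp J).resolve_left (by
    intro h
    apply hchar3
    linear_combination -h)
  exact sbr_comm_zero gY (grd_br gY gY) J'

theorem ann_all (hs : Surjective φ) (hk : LinearMap.ker φ = centerS F K)
    {z : L} (h : ∀ w, Ann F φ z w) : z = 0 := by
  obtain ⟨Z, rfl⟩ := hs z
  have : Z ∈ LinearMap.ker φ := by
    rw [hk]
    intro W
    exact h _ Z W rfl rfl
  exact this

end Cap

section Semi

variable {V : Type v} [AddCommGroup V] [Module F V]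

/-- Even/zero part. -/
def evenF (F : Type u) [Field F] (W : Type v) [AddCommGroup W] [Module F W] (a : ZMod 2) :
    Submodule F W := if a = 0 then ⊤ else ⊥

theorem evenF_one {W : Type v} [AddCommGroup W] [Module F W] {x : W}
    (h : x ∈ evenF F W 1) : x = 0 := by
  simpa [evenF] using h

theorem evenF_zero {W : Type v} [AddCommGroup W] [Module F W] (x : W) :
    x ∈ evenF F W 0 := by
  simp [evenF]

theorem compl_prod {V : Type v} [AddCommGroup V] [Module F V] {W : Type w} [AddCommGroup W]
    [Module F W] {P P' : Submodule F V} {Q Q' : Submodule F W} (h : IsCompl P P')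
    (h' : IsCompl Q Q') : IsCompl (P.prod Q) (P'.prod Q') := by
  constructor
  · rw [disjoint_iff, Submodule.prod_inf_prod, h.inf_eq_bot, h'.inf_eq_bot, Submodule.prod_bot]
  · rw [codisjoint_iff, Submodule.prod_sup_prod, h.sup_eq_top, h'.sup_eq_top, Submodule.prod_top]

theorem compl_evenF (W : Type v) [AddCommGroup W] [Module F W] :
    IsCompl (evenF F W 0) (evenF F W 1) := by
  simpa [evenF] using (isCompl_top_bot : IsCompl (⊤ : Submodule F W) ⊥)

/-- One dimensional extension of an abelian superalgebra by an even derivation. -/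
abbrev semi (G : ZMod 2 → Submodule F V) (hG : IsCompl (G 0) (G 1)) (D : V →ₗ[F] V)
    (hD : ∀ a, ∀ x ∈ G a, D x ∈ G a) : LieSuper F (F × V) where
  gr a := (evenF F F a).prod (G a)
  isCompl_gr := compl_prod (compl_evenF F) hG
  br x y := (0, x.1 • D y.2 - y.1 • D x.2)
  br_add_left x y z := by
    simp only [Prod.fst_add, Prod.snd_add, map_add, Prod.mk_add_mk, add_zero]
    congr 1
    module
  br_add_right x y z := by
    simp only [Prod.fst_add, Prod.snd_add, map_add, Prod.mk_add_mk, add_zero]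
    congr 1
    module
  br_smul_left c x y := by
    refine Prod.ext (by simp) ?_
    simp only [Prod.smul_fst, Prod.smul_snd, map_smul, smul_eq_mul]
    module
  br_smul_right c x y := by
    refine Prod.ext (by simp) ?_
    simp only [Prod.smul_fst, Prod.smul_snd, map_smul, smul_eq_mul]
    module
  br_gr a b x hx y hy := by
    rw [Submodule.mem_prod] at hx hy ⊢
    refine ⟨Submodule.zero_mem _, ?_⟩
    have ha : a = 0 ∨ a = 1 := par a
    have hb : b = 0 ∨ b = 1 := par b
    have h1 : x.1 • D y.2 ∈ G (a + b) := by
      rcases ha with rfl | rfl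
      · rw [zero_add]; exact Submodule.smul_mem _ _ (hD _ _ hy.2)
      · rw [evenF_one hx.1, zero_smul]; exact Submodule.zero_mem _
    have h2 : y.1 • D x.2 ∈ G (a + b) := by
      rcases hb with rfl | rfl
      · rw [add_zero]; exact Submodule.smul_mem _ _ (hD _ _ hx.2)
      · rw [evenF_one hy.1, zero_smul]; exact Submodule.zero_mem _
    exact Submodule.sub_mem _ h1 h2
  br_skew a b x hx y hy := by
    rw [Submodule.mem_prod] at hx hy
    have ha : a = 0 ∨ a = 1 := par a
    have hb : b = 0 ∨ b = 1 := par b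
    rcases ha with rfl | rfl
    · rw [sg_zero_left]; ext <;> simp
    rcases hb with rfl | rfl
    · rw [sg_zero_right]; ext <;> simp
    · rw [evenF_one hx.1, evenF_one hy.1]; ext <;> simp
  br_jacobi a b c x hx y hy z hz := by
    rw [Submodule.mem_prod] at hx hy hz
    have ha : a = 0 ∨ a = 1 := par a
    have hb : b = 0 ∨ b = 1 := par b
    have hc : c = 0 ∨ c = 1 := par c
    simp only [zero_smul, sub_zero, map_sub, map_smul, Prod.smul_mk, smul_zero,
      Prod.mk_add_mk, add_zero]
    refine Prod.ext rfl ?_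
    simp only [Prod.snd_zero]
    rcases ha with rfl | rfl <;> rcases hb with rfl | rfl <;> rcases hc with rfl | rfl <;>
      (first | have ex := evenF_one hx.1 | skip) <;>
      (first | have ey := evenF_one hy.1 | skip) <;>
      (first | have ez := evenF_one hz.1 | skip) <;>
      simp only [sg_zero_left, sg_zero_right, one_smul, *, zero_smul, smul_zero, sub_zero,
        zero_sub, add_zero, zero_add] <;>
      module

end Semi

/-- The derivation used for the cover. -/
def DD (F : Type u) [Field F] (A : Type v) [AddCommGroup A] [Module F A] :
    ((F × F × F) × (A × A)) →ₗ[F] ((F × F × F) × (A × A)) where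
  toFun v := ((0, v.1.1, v.1.2.1), (0, v.2.1))
  map_add' x y := by simp
  map_smul' c x := by simp

/-- The grading used for the cover. -/
def GG (F : Type u) [Field F] (A : Type v) [AddCommGroup A] [Module F A] [LieSuper F A]
    (a : ZMod 2) : Submodule F ((F × F × F) × (A × A)) :=
  (evenF F (F × F × F) a).prod ((grd F A a).prod (grd F A a))

theorem GG_compl (A : Type v) [AddCommGroup A] [Module F A] [LieSuper F A] :
    IsCompl (GG F A 0) (GG F A 1) := by
  have h : IsCompl (grd F A 0) (grd F A 1) := LieSuper.isCompl_gr
  exact compl_prod (compl_evenF _) (compl_prod h h)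

theorem DD_GG (A : Type v) [AddCommGroup A] [Module F A] [LieSuper F A] (a : ZMod 2)
    (x : (F × F × F) × (A × A)) (hx : x ∈ GG F A a) : DD F A x ∈ GG F A a := by
  simp only [GG, Submodule.mem_prod] at hx ⊢
  refine ⟨?_, Submodule.zero_mem _, hx.2.1⟩
  have ha : a = 0 ∨ a = 1 := par a
  rcases ha with rfl | rfl
  · exact evenF_zero _
  · have := evenF_one hx.1
    simp only [DD, LinearMap.coe_mk, AddHom.coe_mk, this]
    exact Submodule.zero_mem _

theorem capable_of {H : Type v} [AddCommGroup H] [Module F H] [LieSuper F H]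
    {A : Type v} [AddCommGroup A] [Module F A] [LieSuper F A] (hA : ∀ x y : A, sbr F x y = 0)
    (p q z : H) (hp : p ∈ grd F H 0) (hq : q ∈ grd F H 0) (hz : z ∈ grd F H 0)
    (hli : ∀ a b c : F, a • p + b • q + c • z = 0 → a = 0 ∧ b = 0 ∧ c = 0)
    (hsp : ∀ h : H, ∃ a b c : F, a • p + b • q + c • z = h)
    (hpp : sbr F p p = 0) (hqq : sbr F q q = 0) (hpq : sbr F p q = z) (hqp : sbr F q p = -z)
    (hzl : ∀ w : H, sbr F z w = 0) (hzr : ∀ w : H, sbr F w z = 0) :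
    Capable F (H × A) := by
  letI inst : LieSuper F (F × ((F × F × F) × (A × A))) :=
    semi (GG F A) (GG_compl A) (DD F A) (DD_GG A)
  let φ : (F × ((F × F × F) × (A × A))) →ₗ[F] H × A :=
    { toFun := fun v => (v.1 • p + v.2.1.1 • q + v.2.1.2.1 • z, v.2.2.1)
      map_add' := fun x y => by
        refine Prod.ext ?_ rfl
        simp only [Prod.fst_add, Prod.snd_add]
        module
      map_smul' := fun c x => by
        refine Prod.ext ?_ rfl
        simp only [Prod.smul_fst, Prod.smul_snd, smul_eq_mul, RingHom.id_apply]
        module }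
  have hbr : ∀ x y : F × ((F × F × F) × (A × A)), sbr F x y =
    (0, x.1 • DD F A y.2 - y.1 • DD F A x.2) := fun _ _ => rfl
  refine ⟨⟨F × ((F × F × F) × (A × A))⟩, φ, ⟨?_, ?_⟩, ?_, ?_⟩
  · intro a x hx
    have hx' : x ∈ (evenF F F a).prod ((evenF F (F × F × F) a).prod
      ((grd F A a).prod (grd F A a))) := hx
    simp only [Submodule.mem_prod] at hx'
    show φ x ∈ (grd F H a).prod (grd F A a)
    refine Submodule.mem_prod.mpr ⟨?_, hx'.2.2.1⟩
    have ha : a = 0 ∨ a = 1 := par a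
    rcases ha with rfl | rfl
    · exact Submodule.add_mem _ (Submodule.add_mem _ (Submodule.smul_mem _ _ hp)
        (Submodule.smul_mem _ _ hq)) (Submodule.smul_mem _ _ hz)
    · have e1 := evenF_one hx'.1
      have e2 := evenF_one hx'.2.1
      show x.1 • p + x.2.1.1 • q + x.2.1.2.1 • z ∈ grd F H 1
      rw [e1, e2]
      simp
  · intro x y
    show φ (sbr F x y) = (sbr F (x.1 • p + x.2.1.1 • q + x.2.1.2.1 • z)
      (y.1 • p + y.2.1.1 • q + y.2.1.2.1 • z), sbr F x.2.2.1 y.2.2.1)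
    rw [hbr, hA]
    refine Prod.ext ?_ ?_
    · simp only [sbr_add_left, sbr_add_right, sbr_smul_left, sbr_smul_right, hpp, hqq, hpq, hqp,
        hzl, hzr]
      simp only [φ, DD, LinearMap.coe_mk, AddHom.coe_mk, Prod.smul_mk, Prod.mk_sub_mk]
      simp only [smul_eq_mul, mul_zero, sub_zero, zero_smul]
      module
    · simp [φ, DD]
  · rintro ⟨h, a⟩
    obtain ⟨c1, c2, c3, rfl⟩ := hsp h
    exact ⟨(c1, ((c2, c3, 0), (a, 0))), rfl⟩
  · ext x
    obtain ⟨t, ⟨⟨b, c, e⟩, ⟨a, a'⟩⟩⟩ := x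
    constructor
    · intro hx
      have hx' : (t • p + b • q + c • z, a) = ((0 : H), (0 : A)) := hx
      obtain ⟨h1, rfl⟩ := Prod.mk.inj hx'
      obtain ⟨rfl, rfl, rfl⟩ := hli _ _ _ h1
      intro y
      show sbr F _ _ = _
      rw [hbr]
      simp [DD]
    · intro hx
      have k1 : sbr F (t, ((b, c, e), (a, a'))) (((1 : F), 0) : F × ((F × F × F) × (A × A))) = 0 :=
        hx _
      have k2 : sbr F (t, ((b, c, e), (a, a')))
        (((0 : F), (((1 : F), 0, 0), 0)) : F × ((F × F × F) × (A × A))) = 0 := hx _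
      rw [hbr] at k1 k2
      have j1 := (Prod.mk.inj k1).2
      have j2 := (Prod.mk.inj k2).2
      clear k1 k2 hx
      simp [DD] at j1 j2
      obtain ⟨⟨rfl, rfl⟩, rfl⟩ := j1
      subst j2
      show ((0 : F) • p + (0 : F) • q + (0 : F) • z, (0 : A)) = ((0 : H), (0 : A))
      simp only [zero_smul, add_zero]

theorem not_capable {K : Type w} [AddCommGroup K] [Module F K] [LieSuper F K]
    (hchar3 : (3 : F) ≠ 0) (m n : ℕ) (hmn : 1 ≤ m + n) (hne : ¬ (m = 1 ∧ n = 0))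
    {H : Type v} [AddCommGroup H] [Module F H] [LieSuper F H] (hH : IsHeisE F m n H)
    {A : Type v} [AddCommGroup A] [Module F A] [LieSuper F A] (hA : ∀ x y : A, sbr F x y = 0)
    {φ : K →ₗ[F] H × A} (hφ : IsHom F φ) (hs : Surjective φ)
    (hk : LinearMap.ker φ = centerS F K) : False := by
  obtain ⟨x, y, z, gx, gz, gy, hli, hsp, hxx, hxy, hyx, hyy, hzl, hzr⟩ := hH
  have hz0 : z ≠ 0 := hli.ne_zero (Sum.inr (Sum.inr ()))
  have pbr : ∀ (h h' : H) (a a' : A), sbr F (h, a) (h', a') = (sbr F h h', 0) := by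
    intro h h' a a'
    show (sbr F h h', sbr F a a') = _
    rw [hA]
  have pgr : ∀ (c : ZMod 2) (h : H) (a : A), h ∈ grd F H c → a ∈ grd F A c →
      (h, a) ∈ grd F (H × A) c := fun c h a h1 h2 => Submodule.mem_prod.mpr ⟨h1, h2⟩
  have main : ∀ (c : ZMod 2) (p q : H), p ∈ grd F H c → q ∈ grd F H c → sbr F p q = z →
      ∀ (d : ZMod 2) (h : H) (a : A), h ∈ grd F H d → a ∈ grd F A d →
      sbr F q h = 0 → sbr F h p = 0 → Ann F φ ((z, 0) : H × A) (h, a) := by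
    intro c p q hp hq hpq d h a hh ha h1 h2
    refine ann_pair hφ hs hk (x := (p, 0)) (y := (q, 0)) (pgr c _ _ hp (zero_mem _))
      (pgr c _ _ hq (zero_mem _)) (pgr d _ _ hh ha) ?_ ?_ ?_
    · rw [pbr, hpq]
    · rw [pbr, h1]; rfl
    · rw [pbr, h2]; rfl
  -- it suffices to treat generators
  have red : ∀ (c : ZMod 2) (p q : H), p ∈ grd F H c → q ∈ grd F H c → sbr F p q = z →
      (∀ i, Ann F φ ((z, 0) : H × A) (x i, 0)) → (∀ j, Ann F φ ((z, 0) : H × A) (y j, 0)) →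
      False := by
    intro c p q hp hq hpq hX hY
    have hall : ∀ w, Ann F φ ((z, 0) : H × A) w := by
      rintro ⟨h, a⟩
      have e1 : Ann F φ ((z, 0) : H × A) (h, 0) := by
        have hh : h ∈ Submodule.span F
          (Set.range (Sum.elim x (Sum.elim y (fun _ : Unit => z)))) := by rw [hsp]; trivial
        induction hh using Submodule.span_induction with
        | mem w hw =>
          obtain ⟨i | j | k, rfl⟩ := hw
          · exact hX i
          · exact hY j
          · exact main c p q hp hq hpq 0 z 0 gz (zero_mem _) (hzr _) (hzl _)
        | zero => exact ann_zero hφ hs hk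
        | add u v _ _ hu hv =>
          have := ann_add hφ hs hk hu hv
          simpa using this
        | smul c u _ hu =>
          have := ann_smul hφ hs hk c hu
          simpa using this
      obtain ⟨a0, h0, a1, h1, rfl⟩ := grd_decomp (F := F) a
      have e2 := main c p q hp hq hpq 0 0 a0 (zero_mem _) h0 (sbr_zero_right _) (sbr_zero_left _)
      have e3 := main c p q hp hq hpq 1 0 a1 (zero_mem _) h1 (sbr_zero_right _) (sbr_zero_left _)
      have := ann_add hφ hs hk e1 (ann_add hφ hs hk e2 e3)
      simpa using this
    have := ann_all hs hk hall
    exact hz0 (Prod.mk.inj this).1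
  rcases Nat.eq_zero_or_pos n with hn | hn
  · subst hn
    have hm : 2 ≤ m := by omega
    have b1 : sbr F (x ⟨0, by omega⟩) (x ⟨m, by omega⟩) = z := by rw [hxx]; simp
    have b2 : sbr F (x ⟨1, by omega⟩) (x ⟨m + 1, by omega⟩) = z := by
      rw [hxx]; simp [add_comm]
    refine red 0 _ _ (gx _) (gx _) b1 ?_ (fun j => j.elim0)
    intro i
    by_cases hi : (i : ℕ) = 0 ∨ (i : ℕ) = m
    · refine main 0 _ _ (gx _) (gx _) b2 0 _ _ (gx _) (zero_mem _) ?_ ?_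
      · rw [hxx, if_neg, if_neg]
        · simp only; omega
        · simp only; omega
      · rw [hxx, if_neg, if_neg]
        · simp only; omega
        · simp only; omega
    · refine main 0 _ _ (gx _) (gx _) b1 0 _ _ (gx _) (zero_mem _) ?_ ?_
      · rw [hxx, if_neg, if_neg]
        · simp only; omega
        · have := i.2
          simp only; omega
      · rw [hxx, if_neg, if_neg]
        · simp only; omega
        · simp only; omega
  · have b1 : sbr F (y ⟨0, hn⟩) (y ⟨0, hn⟩) = z := by rw [hyy]; simp
    refine red 1 _ _ (gy _) (gy _) b1 ?_ ?_
    · intro i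
      exact main 1 _ _ (gy _) (gy _) b1 0 _ _ (gx _) (zero_mem _) (hyx _ _) (hxy _ _)
    · intro j
      by_cases hj : j = ⟨0, hn⟩
      · subst hj
        refine ann_odd hchar3 hφ hs hk (pgr 1 _ _ (gy _) (zero_mem _)) ?_
        rw [pbr, b1]
      · refine main 1 _ _ (gy _) (gy _) b1 1 _ _ (gy _) (zero_mem _) ?_ ?_
        · rw [hyy, if_neg (fun h => hj h.symm)]
        · rw [hyy, if_neg hj]

end Aux

/-- for any `m + n ≥ 1` and any `r + s ≥ 1`, the nilpotent Lie
superalgebra `H(m,n) ⊕ A(r | s)` is capable if and only if `m = 1` and `n = 0`. -/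
theorem heisenberg_even_sum_abelian_capable_iff (F : Type u) [Field F]
    (hchar2 : (2 : F) ≠ 0) (hchar3 : (3 : F) ≠ 0)
    (m n r s : ℕ) (hmn : 1 ≤ m + n) (hrs : 1 ≤ r + s)
    (H : Type v) [AddCommGroup H] [Module F H] [LieSuper F H]
    (hH : IsHeisE F m n H)
    (A : Type v) [AddCommGroup A] [Module F A] [LieSuper F A]
    (hA : IsAbelSuper F r s A) :
    Capable F (H × A) ↔ (m = 1 ∧ n = 0) := by
  constructor
  · rintro ⟨K, φ, hφ, hs, hk⟩
    by_contra hne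
    exact not_capable hchar3 m n hmn hne hH hA.1 hφ hs hk
  · rintro ⟨rfl, rfl⟩
    obtain ⟨x, y, z, gx, gz, gy, hli, hsp, hxx, hxy, hyx, hyy, hzl, hzr⟩ := hH
    refine capable_of hA.1 (x 0) (x 1) z (gx _) (gx _) gz ?_ ?_ ?_ ?_ ?_ ?_ hzl hzr
    · intro a b c h
      rw [Fintype.linearIndependent_iff] at hli
      have := hli (Sum.elim ![a, b] (Sum.elim 0 (fun _ => c))) (by
        rw [Fintype.sum_sum_type, Fintype.sum_sum_type]
        simp only [Sum.elim_inl, Sum.elim_inr, Finset.univ_eq_empty, Finset.sum_empty,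
          Finset.univ_unique, Finset.sum_singleton, zero_add]
        erw [Fin.sum_univ_two]
        exact h)
      exact ⟨this (Sum.inl 0), this (Sum.inl 1), this (Sum.inr (Sum.inr ()))⟩
    · intro h
      have hh : h ∈ Submodule.span F
          (Set.range (Sum.elim x (Sum.elim y (fun _ : Unit => z)))) := by rw [hsp]; trivial
      induction hh using Submodule.span_induction with
      | mem w hw =>
        obtain ⟨i | j | k, rfl⟩ := hw
        · have hi : i = 0 ∨ i = 1 := by revert i; decide
          rcases hi with rfl | rfl
          · exact ⟨1, 0, 0, by simp⟩
          · exact ⟨0, 1, 0, by simp⟩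
        · exact j.elim0
        · exact ⟨0, 0, 1, by simp⟩
      | zero => exact ⟨0, 0, 0, by simp⟩
      | add u v _ _ hu hv =>
        obtain ⟨a, b, c, rfl⟩ := hu
        obtain ⟨a', b', c', rfl⟩ := hv
        exact ⟨a + a', b + b', c + c', by module⟩
      | smul d u _ hu =>
        obtain ⟨a, b, c, rfl⟩ := hu
        exact ⟨d * a, d * b, d * c, by module⟩
    · rw [hxx]; simp
    · rw [hxx]; simp
    · rw [hxx]; simp
    · rw [hxx]; simp

end SuperLie
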